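/- Let N ≥ 1 and define the N×N matrices T_k = (δ_{j−i,k})_{i,j=1}^N (single-diagonal Toeplitz), H_k = (δ_{i+j,k})_{i,j=1}^N (single-antidiagonal Hankel), and A_k = 2I − T_k − T_{−k} + H_{k+1} + H_{2N−k+1} for k = 1, …, N−1, together with A_N = I + H_{N+1}. Then each A_k, k = 1, …, N, is symmetric, weakly diagonally dominant with positive diagonal, and positive semidefinite; moreover the tridiagonal matrix A_1 has full rank and is positive definite. -/

import Mathlib

/-- Single-diagonal Toeplitz matrix `T_k = (δ_{j−i,k})` (1-based indices, same as 0-based). -/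
def Tmat (N : ℕ) (k : ℤ) : Matrix (Fin N) (Fin N) ℝ :=
  fun i j => if ((j : ℕ) : ℤ) - ((i : ℕ) : ℤ) = k then 1 else 0

/-- Single-antidiagonal Hankel matrix `H_k = (δ_{i+j,k})` with 1-based indices. -/
def Hmat (N : ℕ) (k : ℕ) : Matrix (Fin N) (Fin N) ℝ :=
  fun i j => if ((i : ℕ) + 1) + ((j : ℕ) + 1) = k then 1 else 0

/-- `A_k = 2I − T_k − T_{−k} + H_{k+1} + H_{2N−k+1}` for `k = 1,…,N−1`, and `A_N = I + H_{N+1}`. -/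
def Amat (N : ℕ) (k : ℕ) : Matrix (Fin N) (Fin N) ℝ :=
  if k = N then 1 + Hmat N (N + 1)
  else 2 • (1 : Matrix (Fin N) (Fin N) ℝ) - Tmat N (k : ℤ) - Tmat N (-(k : ℤ))
    + Hmat N (k + 1) + Hmat N (2 * N - k + 1)

/-- A row of a single-entry indicator sums to at most one. -/
theorem sum_erase_ite_val_eq_le_one {N : ℕ} (i : Fin N) (m : ℕ) :
    ∑ j ∈ Finset.univ.erase i, (if (j : ℕ) = m then (1 : ℝ) else 0) ≤ 1 := by
  rw [Finset.sum_boole]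
  norm_cast
  refine Finset.card_le_one.2 fun a ha b hb => ?_
  simp only [Finset.mem_filter] at ha hb
  exact Fin.ext (ha.2.trans hb.2.symm)

/-- A real symmetric, weakly diagonally dominant matrix is positive semidefinite. -/
theorem Matrix.IsSymm.posSemidef_of_sum_abs_le_diag {n : Type*} [Fintype n] [DecidableEq n]
    {A : Matrix n n ℝ} (hA : A.IsSymm)
    (h : ∀ i, ∑ j ∈ Finset.univ.erase i, |A i j| ≤ A i i) : A.PosSemidef := by
  have hH : A.IsHermitian := by
    rw [Matrix.IsHermitian, Matrix.conjTranspose_eq_transpose_of_trivial]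
    exact hA
  refine hH.posSemidef_iff_eigenvalues_nonneg.2 fun k => ?_
  have hk : Module.End.HasEigenvalue (Matrix.toLin' A) (hH.eigenvalues k) := by
    rw [Module.End.hasEigenvalue_iff_mem_spectrum, Matrix.spectrum_toLin']
    exact hH.eigenvalues_mem_spectrum_real k
  obtain ⟨i, hi⟩ := eigenvalue_mem_ball hk
  rw [Metric.mem_closedBall, Real.dist_eq] at hi
  simp only [Real.norm_eq_abs] at hi
  have := h i
  have := abs_le.1 hi
  simp only [Pi.zero_apply]
  linarith

theorem Amat_isSymm (N k : ℕ) : (Amat N k).IsSymm := by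
  ext i j
  simp only [Matrix.transpose_apply, Amat]
  split_ifs
  · simp only [Matrix.add_apply, Matrix.one_apply, Hmat, Fin.ext_iff]
    grind
  · simp only [Matrix.add_apply, Matrix.sub_apply, Matrix.smul_apply, Matrix.one_apply, Tmat,
      Hmat, Fin.ext_iff]
    grind

theorem one_le_Amat_self {N : ℕ} (i : Fin N) : 1 ≤ Amat N N i i := by
  simp only [Amat, if_true, Matrix.add_apply, Matrix.one_apply, Hmat]
  split_ifs <;> norm_num

theorem two_le_Amat_self {N k : ℕ} (hk : 1 ≤ k) (hkN : k ≠ N) (i : Fin N) :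
    2 ≤ Amat N k i i := by
  have h1 : (0 : ℤ) ≠ k := by omega
  have h2 : (0 : ℤ) ≠ -k := by omega
  simp only [Amat, if_neg hkN, Matrix.add_apply, Matrix.sub_apply, Matrix.smul_apply,
    Matrix.one_apply, Tmat, Hmat, sub_self, if_true, if_neg h1, if_neg h2]
  split_ifs <;> norm_num

theorem abs_Amat_self_apply_le {N : ℕ} {i j : Fin N} (hij : j ≠ i) :
    |Amat N N i j| ≤ if (j : ℕ) = N - 1 - i then 1 else 0 := by
  have hij' : i ≠ j := hij.symm
  simp only [Amat, if_true, Matrix.add_apply, Matrix.one_apply, Hmat, if_neg hij']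
  split_ifs <;> first | omega | norm_num

theorem abs_Amat_apply_le {N k : ℕ} (hk : 1 ≤ k) (hkN : k < N) {i j : Fin N} (hij : j ≠ i) :
    |Amat N k i j| ≤
      (if (j : ℕ) = (if i + k < N then i + k else 2 * N - k - 1 - i) then 1 else 0) +
      (if (j : ℕ) = (if k ≤ i then i - k else k - 1 - i) then 1 else 0) := by
  have hij' : i ≠ j := hij.symm
  have hi := i.2
  have hj := j.2
  simp only [Amat, if_neg hkN.ne, Matrix.add_apply, Matrix.sub_apply, Matrix.smul_apply,
    Matrix.one_apply, Tmat, Hmat, if_neg hij', smul_zero, zero_sub]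
  split_ifs <;> first | omega | norm_num

theorem Amat_self_pos {N k : ℕ} (hk : 1 ≤ k) (i : Fin N) : 0 < Amat N k i i := by
  rcases eq_or_ne k N with rfl | hkN
  · linarith [one_le_Amat_self i]
  · linarith [two_le_Amat_self hk hkN i]

theorem sum_abs_Amat_le {N k : ℕ} (hk : 1 ≤ k) (hkN : k ≤ N) (i : Fin N) :
    ∑ j ∈ Finset.univ.erase i, |Amat N k i j| ≤ Amat N k i i := by
  rcases hkN.eq_or_lt with rfl | hlt
  · exact (Finset.sum_le_sum fun j hj => abs_Amat_self_apply_le (Finset.ne_of_mem_erase hj)).trans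
      ((sum_erase_ite_val_eq_le_one i _).trans (one_le_Amat_self i))
  · refine (Finset.sum_le_sum fun j hj =>
      abs_Amat_apply_le hk hlt (Finset.ne_of_mem_erase hj)).trans ?_
    rw [Finset.sum_add_distrib]
    linarith [sum_erase_ite_val_eq_le_one i (if i + k < N then i + k else 2 * N - k - 1 - i),
      sum_erase_ite_val_eq_le_one i (if k ≤ i then i - k else k - 1 - i),
      two_le_Amat_self hk hlt.ne i]

/-- Extension by zero of a vector to all natural indices. -/
def extendZero {N : ℕ} (x : Fin N → ℝ) (m : ℕ) : ℝ := if h : m < N then x ⟨m, h⟩ else 0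

theorem sum_ite_val_eq_mul {N : ℕ} (x : Fin N → ℝ) (m : ℕ) :
    ∑ j : Fin N, (if (j : ℕ) = m then (1 : ℝ) else 0) * x j = extendZero x m := by
  unfold extendZero
  split_ifs with h
  · rw [Finset.sum_eq_single ⟨m, h⟩]
    · simp
    · intro b _ hb
      rw [if_neg fun hbm => hb (Fin.ext hbm), zero_mul]
    · simp
  · refine Finset.sum_eq_zero fun j _ => ?_
    rw [if_neg (by omega), zero_mul]

/-- The rows of `A_1`, read off on the extension by zero of a vector. -/
theorem Amat_one_mulVec {N : ℕ} (hN : 1 < N) (x : Fin N → ℝ) (i : Fin N) :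
    (Amat N 1).mulVec x i = 2 * extendZero x i - extendZero x (i + 1)
      - (if (i : ℕ) = 0 then -extendZero x 0 else extendZero x (i - 1))
      + (if (i : ℕ) + 1 = N then extendZero x i else 0) := by
  have hi := i.2
  have key : ∀ j : Fin N, Amat N 1 i j =
      2 * (if (j : ℕ) = i then 1 else 0) - (if (j : ℕ) = i + 1 then 1 else 0)
      - (if (i : ℕ) = 0 then -(if (j : ℕ) = 0 then 1 else 0)
          else (if (j : ℕ) = i - 1 then 1 else 0))
      + (if (i : ℕ) + 1 = N then (if (j : ℕ) = i then 1 else 0) else 0) := by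
    intro j
    have hj := j.2
    have c1 : i = j ↔ (j : ℕ) = i := by rw [Fin.ext_iff, eq_comm]
    have c2 : ((j : ℕ) : ℤ) - (i : ℕ) = (1 : ℕ) ↔ (j : ℕ) = i + 1 := by omega
    have c3 : ((j : ℕ) : ℤ) - (i : ℕ) = -(1 : ℕ) ↔ (i : ℕ) ≠ 0 ∧ (j : ℕ) = i - 1 := by omega
    have c4 : (i : ℕ) + 1 + (j + 1) = 1 + 1 ↔ (i : ℕ) = 0 ∧ (j : ℕ) = 0 := by omega
    have c5 : (i : ℕ) + 1 + (j + 1) = 2 * N - 1 + 1 ↔ (i : ℕ) + 1 = N ∧ (j : ℕ) = i := by omega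
    simp only [Amat, if_neg hN.ne, Matrix.add_apply, Matrix.sub_apply,
      Matrix.one_apply, Tmat, Hmat, c1, c2, c3, c4, c5, two_nsmul, ite_and]
    by_cases h0 : (i : ℕ) = 0 <;> by_cases h1 : (i : ℕ) + 1 = N <;>
      simp only [h0, h1, ne_eq, not_true_eq_false, not_false_eq_true,
        if_true, if_false] <;> ring
  simp only [Matrix.mulVec, dotProduct, key, ← sum_ite_val_eq_mul x]
  split_ifs <;>
    simp only [add_mul, sub_mul, neg_mul, zero_mul, mul_assoc, Finset.sum_add_distrib,
      Finset.sum_sub_distrib, Finset.sum_neg_distrib, Finset.sum_const_zero, Finset.mul_sum]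

theorem eq_zero_of_Amat_one_mulVec_eq_zero {N : ℕ} (hN : 1 < N) {x : Fin N → ℝ}
    (hx : (Amat N 1).mulVec x = 0) : x = 0 := by
  have row (i : ℕ) (hi : i < N) := (Amat_one_mulVec hN x ⟨i, hi⟩).symm.trans (congrFun hx ⟨i, hi⟩)
  simp only [Pi.zero_apply] at row
  have lin : ∀ m, (m < N → extendZero x m = (2 * m + 1) * extendZero x 0) ∧
      (m + 1 < N → extendZero x (m + 1) = (2 * m + 3) * extendZero x 0) := by
    intro m
    induction m with
    | zero =>
      refine ⟨fun _ => by simp, fun h => ?_⟩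
      have := row 0 (by omega)
      rw [if_pos rfl, if_neg (by omega)] at this
      push_cast
      linarith
    | succ m ih =>
      refine ⟨fun h => ?_, fun h => ?_⟩
      · rw [ih.2 h]
        push_cast
        ring
      · have := row (m + 1) (by omega)
        rw [if_neg (by omega), if_neg (by omega), Nat.add_sub_cancel, ih.1 (by omega),
          ih.2 (by omega)] at this
        push_cast
        linarith
  have h0 : extendZero x 0 = 0 := by
    obtain ⟨M, rfl⟩ : ∃ M, N = M + 2 := ⟨N - 2, by omega⟩
    have := row (M + 1) (by omega)
    have hout : extendZero x (M + 1 + 1) = 0 := dif_neg (by omega)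
    rw [if_neg (by omega), if_pos rfl, Nat.add_sub_cancel, (lin M).1 (by omega),
      (lin M).2 (by omega), hout] at this
    have hM : (4 * (M : ℝ) + 8) * extendZero x 0 = 0 := by linarith
    exact (mul_eq_zero.1 hM).resolve_left (by positivity)
  ext i
  have := (lin i).1 i.2
  rw [h0, mul_zero] at this
  simpa [extendZero] using this

theorem Amat_one_isUnit {N : ℕ} (hN : 1 ≤ N) : IsUnit (Amat N 1) := by
  rcases hN.eq_or_lt with rfl | hlt
  · rw [Matrix.isUnit_iff_isUnit_det, Matrix.det_fin_one]
    exact (Amat_self_pos le_rfl 0).ne'.isUnit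
  · rw [← Matrix.mulVec_injective_iff_isUnit]
    refine (injective_iff_map_eq_zero (Amat N 1).mulVecLin).2 fun x hx => ?_
    exact eq_zero_of_Amat_one_mulVec_eq_zero hlt hx

theorem Amat_posSemidef {N k : ℕ} (hk : 1 ≤ k) (hkN : k ≤ N) : (Amat N k).PosSemidef :=
  (Amat_isSymm N k).posSemidef_of_sum_abs_le_diag (sum_abs_Amat_le hk hkN)

/-- Each `A_k`, `k = 1,…,N`, is symmetric, weakly diagonally dominant with
positive diagonal, and positive semidefinite; moreover the tridiagonal matrix `A_1` has full
rank and is positive definite. -/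
theorem stmt10 (N : ℕ) (hN : 1 ≤ N) :
    (∀ k ∈ Finset.Icc 1 N,
      (Amat N k).IsSymm ∧
      (∀ i, 0 < Amat N k i i) ∧
      (∀ i, ∑ j ∈ Finset.univ.erase i, |Amat N k i j| ≤ Amat N k i i) ∧
      (Amat N k).PosSemidef) ∧
    (Amat N 1).rank = N ∧ (Amat N 1).PosDef := by
  refine ⟨fun k hk => ?_, ?_, (Amat_posSemidef le_rfl hN).posDef_iff_isUnit.2 (Amat_one_isUnit hN)⟩
  · obtain ⟨hk, hkN⟩ := Finset.mem_Icc.1 hk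
    exact ⟨Amat_isSymm N k, Amat_self_pos hk, sum_abs_Amat_le hk hkN, Amat_posSemidef hk hkN⟩
  · rw [Matrix.rank_of_isUnit _ (Amat_one_isUnit hN), Fintype.card_fin]
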